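/- arXiv:1208.6286 — 3 statements merged into one kernel-verified Lean document; each statement's English description precedes it below -/
import Mathlib

section
/- Let c ∈ ℭ_+(N) and let m_1, …, m_n be complex numbers. Then the functional J attains its minimum over closure(𝔓°_+(N)) × closure(𝔓_+(N)) at some pair (P̂, Q̂), and for every minimizing pair (P̂, Q̂) there exists a function Φ̂ : {ζ_{-N+1}, …, ζ_N} → [0,∞) with Φ̂(ζ_j) = P̂(ζ_j)/Q̂(ζ_j) whenever Q̂(ζ_j) > 0, such that (1/(2N)) Σ_{j=-N+1}^{N} ζ_j^k Φ̂(ζ_j) = c_k for k = 0, 1, …, n. -/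
open Complex Finset Filter Topology

noncomputable section

/-- Coefficient space for symmetric trigonometric polynomials of degree `n`:
`(p₀, (p₁, …, pₙ))` with `p₀` real and `p₋ₖ = conj pₖ` implicit. Also used for
covariance data `c = (c₀, (c₁, …, cₙ))`. -/
abbrev Coef (n : ℕ) := ℝ × (Fin n → ℂ)

/-- The `2N`-th roots of unity `ζ_j = exp(iπj/N)`. -/
def zet (N : ℕ) (j : ℤ) : ℂ := Complex.exp (Real.pi * Complex.I * j / N)

/-- The index set `j = -N+1, …, N`. -/
def idxs (N : ℕ) : Finset ℤ := Finset.Icc (-(N : ℤ) + 1) N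

/-- Evaluation of `P(z) = Σ_{k=-n}^n p_k z^{-k}` (with `p₋ₖ = conj pₖ`). -/
def evalC {n : ℕ} (p : Coef n) (z : ℂ) : ℂ :=
  (p.1 : ℂ) + ∑ k : Fin n,
    (p.2 k * z⁻¹ ^ ((k : ℕ) + 1) + (starRingEnd ℂ) (p.2 k) * z ^ ((k : ℕ) + 1))

/-- Real value of the symmetric trigonometric polynomial on the unit circle. -/
def evalR {n : ℕ} (p : Coef n) (z : ℂ) : ℝ := (evalC p z).re

/-- The open cone `𝔓₊(N)`. -/
def Pplus (n N : ℕ) : Set (Coef n) := {p | ∀ j ∈ idxs N, 0 < evalR p (zet N j)}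

/-- The closure of `𝔓₊(N)`: `P(ζ_j) ≥ 0` for all `j`. -/
def Pnn (n N : ℕ) : Set (Coef n) := {p | ∀ j ∈ idxs N, 0 ≤ evalR p (zet N j)}

/-- The cone `𝔓₊` of trigonometric polynomials positive on the whole circle. -/
def PplusC (n : ℕ) : Set (Coef n) :=
  {p | ∀ θ ∈ Set.Icc (-Real.pi) Real.pi, 0 < evalR p (Complex.exp (θ * Complex.I))}

/-- The closure of `𝔓₊`: nonnegative on the whole circle. -/
def PnnC (n : ℕ) : Set (Coef n) :=
  {p | ∀ θ ∈ Set.Icc (-Real.pi) Real.pi, 0 ≤ evalR p (Complex.exp (θ * Complex.I))}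

/-- The pairing `⟨C,P⟩ = Σ_{k=-n}^n c_k conj(p_k)` (a real number). -/
def pairCP {n : ℕ} (c p : Coef n) : ℝ :=
  c.1 * p.1 + ∑ k : Fin n, 2 * (c.2 k * (starRingEnd ℂ) (p.2 k)).re

/-- The open dual cone `ℭ₊(N)`. -/
def Cplus (n N : ℕ) : Set (Coef n) := {c | ∀ p ∈ Pnn n N, p ≠ 0 → 0 < pairCP c p}

/-- The open dual cone `ℭ₊`. -/
def CplusC (n : ℕ) : Set (Coef n) := {c | ∀ p ∈ PnnC n, p ≠ 0 → 0 < pairCP c p}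

/-- The discrete moment `(1/(2N)) Σ_j ζ_j^k Φ(ζ_j)`. -/
def dmom (N : ℕ) (Φ : ℤ → ℝ) (k : ℤ) : ℂ :=
  (1 / (2 * (N : ℂ))) * ∑ j ∈ idxs N, zet N j ^ k * (Φ j : ℂ)

/-- `Φ` (a function of the index `j`) satisfies the moment conditions for `c`. -/
def MomCond {n : ℕ} (N : ℕ) (c : Coef n) (Φ : ℤ → ℝ) : Prop :=
  dmom N Φ 0 = (c.1 : ℂ) ∧ ∀ k : Fin n, dmom N Φ ((k : ℕ) + 1) = c.2 k

/-- The function `j ↦ P(ζ_j)/Q(ζ_j)`. -/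
def phiOf {n : ℕ} (N : ℕ) (P Q : Coef n) : ℤ → ℝ :=
  fun j => evalR P (zet N j) / evalR Q (zet N j)

/-- The dual functional `J_P(Q) = ⟨C,Q⟩ − (1/(2N)) Σ_j P(ζ_j) log Q(ζ_j)`. -/
def JP {n : ℕ} (N : ℕ) (c P Q : Coef n) : ℝ :=
  pairCP c Q - (1 / (2 * (N : ℝ))) * ∑ j ∈ idxs N,
    evalR P (zet N j) * Real.log (evalR Q (zet N j))

/-- The moment map `F^P`, with components `F^P_k(Q) = (1/(2N)) Σ_j ζ_j^k P(ζ_j)/Q(ζ_j)`. -/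
def Fmap {n : ℕ} (N : ℕ) (P Q : Coef n) : Coef n :=
  ((dmom N (phiOf N P Q) 0).re, fun k => dmom N (phiOf N P Q) ((k : ℕ) + 1))

/-- One term `P(ζ_j) log(P(ζ_j)/Q(ζ_j))` of the extended functional `J`, with the
conventions `0·log(0/q) = 0` for `q ≥ 0` and `p·log(p/0) = +∞` for `p > 0`. -/
def Jterm (Pj Qj : ℝ) : EReal :=
  if Pj = 0 then 0 else if Qj = 0 then ⊤ else ((Pj * Real.log (Pj / Qj) : ℝ) : EReal)

/-- The extended functional
`J(P,Q) = ⟨C,Q⟩ − ⟨M,P⟩ + (1/(2N)) Σ_j P(ζ_j) log(P(ζ_j)/Q(ζ_j))`, valued in `ℝ ∪ {+∞}`. -/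
def JExt {n : ℕ} (N : ℕ) (c : Coef n) (m : Fin n → ℂ) (P Q : Coef n) : EReal :=
  ((pairCP c Q - pairCP ((0 : ℝ), m) P : ℝ) : EReal) +
    ((1 / (2 * (N : ℝ)) : ℝ) : EReal) *
      ∑ j ∈ idxs N, Jterm (evalR P (zet N j)) (evalR Q (zet N j))

/-- The domain `closure(𝔓°₊(N)) × closure(𝔓₊(N))`. -/
def DomCl (n N : ℕ) : Set (Coef n × Coef n) :=
  {PQ | PQ.1 ∈ Pnn n N ∧ PQ.1.1 = 1 ∧ PQ.2 ∈ Pnn n N}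

/-- The discrete logarithmic moment `(1/(2N)) Σ_j ζ_j^k log Φ(ζ_j)`. -/
def lmom (N : ℕ) (Φ : ℤ → ℝ) (k : ℤ) : ℂ :=
  (1 / (2 * (N : ℂ))) * ∑ j ∈ idxs N, zet N j ^ k * ((Real.log (Φ j) : ℝ) : ℂ)

/-- The entropy gain `(1/(2N)) Σ_j log Φ(ζ_j)`. -/
def entGain (N : ℕ) (Φ : ℤ → ℝ) : ℝ :=
  (1 / (2 * (N : ℝ))) * ∑ j ∈ idxs N, Real.log (Φ j)

/-- Farkas' lemma for finitely many vectors contained in an affine hyperplane `f = 1`. -/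
theorem exists_nonneg_sum_smul_eq {E ι : Type*} [NormedAddCommGroup E] [NormedSpace ℝ E]
    (s : Finset ι) (a : ι → E) (f : E →L[ℝ] ℝ) (ha : ∀ i ∈ s, f (a i) = 1) (x : E)
    (hx : ∀ g : E →L[ℝ] ℝ, (∀ i ∈ s, 0 ≤ g (a i)) → 0 ≤ g x) :
    ∃ μ : ι → ℝ, (∀ i, 0 ≤ μ i) ∧ ∑ i ∈ s, μ i • a i = x := by
  classical
  let A : (ι → ℝ) → E := fun μ => ∑ i ∈ s, μ i • a i
  let K : Set E := A '' {μ | ∀ i, 0 ≤ μ i}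
  have hA : Continuous A := by fun_prop
  have hfA : ∀ μ, f (A μ) = ∑ i ∈ s, μ i := fun μ => by
    simp only [A, map_sum, map_smul, smul_eq_mul]
    exact Finset.sum_congr rfl fun i hi => by rw [ha i hi, mul_one]
  have hclosed : IsClosed K := by
    refine isClosed_of_closure_subset fun y hy => ?_
    let B : Set (ι → ℝ) := Set.pi Set.univ fun _ => Set.Icc 0 (f y + 1)
    have hB : IsCompact (A '' B) :=
      (isCompact_univ_pi fun _ => isCompact_Icc).image hA
    have hO : IsOpen {z | f z < f y + 1} := isOpen_lt f.continuous continuous_const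
    have hsub : {z | f z < f y + 1} ∩ K ⊆ A '' B := by
      rintro _ ⟨hz, μ, hμ, rfl⟩
      refine ⟨fun i => if i ∈ s then μ i else 0, fun i _ => ?_, ?_⟩
      · have hz' : ∑ i ∈ s, μ i < f y + 1 := by simpa [hfA] using hz
        have h0 : 0 ≤ ∑ i ∈ s, μ i := Finset.sum_nonneg fun i _ => hμ i
        by_cases hi : i ∈ s
        · simpa [hi] using And.intro (hμ i)
            ((Finset.single_le_sum (fun i _ => hμ i) hi).trans hz'.le)
        · simpa [hi] using (h0.trans hz'.le)
      · exact Finset.sum_congr rfl fun i hi => by simp [hi]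
    have hy' : y ∈ A '' B := hB.isClosed.closure_subset_iff.2 hsub
      (hO.inter_closure ⟨by simp, hy⟩)
    obtain ⟨μ, hμ, rfl⟩ := hy'
    exact ⟨μ, fun i => (hμ i trivial).1, rfl⟩
  let C : ProperCone ℝ E :=
    { carrier := K
      add_mem' := by
        rintro _ _ ⟨μ, hμ, rfl⟩ ⟨ν, hν, rfl⟩
        exact ⟨μ + ν, fun i => add_nonneg (hμ i) (hν i), by
          simp [A, add_smul, Finset.sum_add_distrib]⟩
      zero_mem' := ⟨0, fun _ => le_rfl, by simp [A]⟩
      smul_mem' := by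
        rintro ⟨r, hr⟩ _ ⟨μ, hμ, rfl⟩
        exact ⟨r • μ, fun i => mul_nonneg hr (hμ i), by
          simp [A, Finset.smul_sum, mul_smul]⟩
      isClosed' := hclosed }
  have hxC : x ∈ C := by
    by_contra hxC
    obtain ⟨g, hg, hgx⟩ := C.hyperplane_separation_point hxC
    refine (hx g fun i hi => hg _ ⟨Pi.single i 1, fun j => ?_, ?_⟩).not_gt hgx
    · by_cases h : j = i
      · subst h; simp
      · simp [h]
    · simp [A, Pi.single_apply, hi]
  exact hxC

/-! ### The relative entropy term -/

theorem Jterm_ne_bot (p q : ℝ) : Jterm p q ≠ ⊥ := by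
  unfold Jterm
  split_ifs
  · simp
  · simp
  · exact EReal.coe_ne_bot _

theorem Jterm_eq_coe {p q : ℝ} (h : q = 0 → p = 0) :
    Jterm p q = ((p * Real.log (p / q) : ℝ) : EReal) := by
  unfold Jterm
  split_ifs with hp hq
  · simp [hp]
  · exact absurd (h hq) hp
  · rfl

/-- Young's inequality `p log (p / q) ≥ (s + 1) p - q exp s`. -/
theorem coe_le_Jterm {p q : ℝ} (hp : 0 ≤ p) (hq : 0 ≤ q) (s : ℝ) :
    (((s + 1) * p - q * Real.exp s : ℝ) : EReal) ≤ Jterm p q := by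
  unfold Jterm
  split_ifs with hp0 hq0
  · subst hp0
    exact_mod_cast (by nlinarith [Real.exp_pos s] : (s + 1) * 0 - q * Real.exp s ≤ 0)
  · exact le_top
  · have hp' : 0 < p := hp.lt_of_ne' hp0
    have hq' : 0 < q := hq.lt_of_ne' hq0
    refine EReal.coe_le_coe_iff.2 ?_
    have h := Real.log_le_sub_one_of_pos (x := q * Real.exp s / p) (by positivity)
    rw [Real.log_div (by positivity) hp0, Real.log_mul hq0 (Real.exp_ne_zero _),
      Real.log_exp] at h
    rw [Real.log_div hp0 hq0]
    have h2 := mul_le_mul_of_nonneg_left h hp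
    have h3 : p * (q * Real.exp s / p - 1) = q * Real.exp s - p := by field_simp
    rw [h3] at h2
    linarith

theorem lowerSemicontinuousOn_Jterm :
    LowerSemicontinuousOn (fun x : ℝ × ℝ => Jterm x.1 x.2) {x | 0 ≤ x.1 ∧ 0 ≤ x.2} := by
  rintro ⟨p, q⟩ ⟨hp, hq⟩ y hy
  obtain ⟨s, hs⟩ : ∃ s : ℝ, y < (((s + 1) * p - q * Real.exp s : ℝ) : EReal) := by
    simp only [Jterm] at hy
    split_ifs at hy with hp0 hq0
    · subst hp0
      have h : Tendsto (fun s : ℝ => (((s + 1) * 0 - q * Real.exp s : ℝ) : EReal)) atBot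
          (𝓝 ((0 : ℝ) : EReal)) := by
        refine (continuous_coe_real_ereal.tendsto _).comp ?_
        simpa using (Real.tendsto_exp_atBot.const_mul q).neg
      exact (h.eventually (lt_mem_nhds hy)).exists
    · subst hq0
      obtain ⟨r, hr, -⟩ := EReal.lt_iff_exists_real_btwn.1 hy
      exact ⟨r / p - 1, by simpa [div_mul_cancel₀ _ hp0] using hr⟩
    · refine ⟨Real.log (p / q), hy.trans_eq ?_⟩
      have hp' : 0 < p := hp.lt_of_ne' hp0
      have hq' : 0 < q := hq.lt_of_ne' hq0
      rw [Real.exp_log (by positivity), mul_div_cancel₀ _ hq0]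
      congr 1; ring
  have hcont : Continuous fun x : ℝ × ℝ =>
      (((s + 1) * x.1 - x.2 * Real.exp s : ℝ) : EReal) :=
    continuous_coe_real_ereal.comp (by fun_prop)
  filter_upwards [mem_nhdsWithin_of_mem_nhds (hcont.continuousAt.eventually (lt_mem_nhds hs)),
    self_mem_nhdsWithin] with x hx hx'
  exact hx.trans_le (coe_le_Jterm hx'.1 hx'.2 s)

theorem EReal.coe_finset_sum {ι : Type*} (s : Finset ι) (f : ι → ℝ) :
    ((∑ i ∈ s, f i : ℝ) : EReal) = ∑ i ∈ s, (f i : EReal) := by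
  classical
  induction s using Finset.induction_on with
  | empty => simp
  | insert a s ha ih => simp [Finset.sum_insert ha, ih]

theorem EReal.finset_sum_ne_bot {ι : Type*} (s : Finset ι) (f : ι → EReal)
    (h : ∀ i ∈ s, f i ≠ ⊥) : ∑ i ∈ s, f i ≠ ⊥ := by
  classical
  induction s using Finset.induction_on with
  | empty => simp
  | insert a s ha ih =>
    rw [Finset.sum_insert ha, Ne, EReal.add_eq_bot_iff, not_or]
    exact ⟨h a (by simp), ih fun i hi => h i (by simp [hi])⟩

theorem EReal.finset_sum_eq_top {ι : Type*} {s : Finset ι} {f : ι → EReal}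
    (h : ∀ i ∈ s, f i ≠ ⊥) {i : ι} (hi : i ∈ s) (hfi : f i = ⊤) : ∑ i ∈ s, f i = ⊤ := by
  classical
  rw [← Finset.add_sum_erase s f hi, hfi]
  exact EReal.top_add_of_ne_bot
    (EReal.finset_sum_ne_bot _ _ fun j hj => h j (Finset.mem_of_mem_erase hj))

theorem lowerSemicontinuousOn_finset_sum_ereal {α ι : Type*} [TopologicalSpace α] {t : Set α}
    (s : Finset ι) (f : ι → α → EReal) (hf : ∀ i ∈ s, LowerSemicontinuousOn (f i) t)
    (hbot : ∀ i ∈ s, ∀ x, f i x ≠ ⊥) :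
    LowerSemicontinuousOn (fun x => ∑ i ∈ s, f i x) t := by
  classical
  induction s using Finset.induction_on with
  | empty => simpa using! lowerSemicontinuousOn_const
  | insert a s ha ih =>
    simp only [Finset.sum_insert ha]
    refine (hf a (by simp)).add' (ih (fun i hi => hf i (by simp [hi]))
      fun i hi => hbot i (by simp [hi])) fun x _ => EReal.continuousAt_add (.inr ?_) (.inl ?_)
    · exact EReal.finset_sum_ne_bot _ _ fun i hi => hbot i (by simp [hi]) x
    · exact hbot a (by simp) x

/-! ### The pairing and evaluation at roots of unity -/

/-- The pairing `pairCP` as a bilinear map. -/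
def pairLin (n : ℕ) : Coef n →ₗ[ℝ] Coef n →ₗ[ℝ] ℝ :=
  LinearMap.mk₂ ℝ pairCP
    (fun a b p => by
      simp only [pairCP, Prod.fst_add, Prod.snd_add, Pi.add_apply, add_mul, Complex.add_re,
        mul_add, Finset.sum_add_distrib]
      ring)
    (fun r a p => by
      simp only [pairCP, Prod.smul_fst, Prod.smul_snd, Pi.smul_apply, smul_eq_mul,
        Complex.real_smul, mul_assoc, Complex.re_ofReal_mul, mul_add, Finset.mul_sum]
      congr 1
      exact Finset.sum_congr rfl fun k _ => by ring)
    (fun a p q => by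
      simp only [pairCP, Prod.fst_add, Prod.snd_add, Pi.add_apply, map_add, Complex.add_re,
        mul_add, Finset.sum_add_distrib]
      ring)
    (fun r a p => by
      simp only [pairCP, Prod.smul_fst, Prod.smul_snd, Pi.smul_apply, smul_eq_mul,
        Complex.real_smul, map_mul, Complex.conj_ofReal, mul_left_comm _ (r : ℂ),
        Complex.re_ofReal_mul, mul_add, Finset.mul_sum]
      congr 1
      · ring
      · exact Finset.sum_congr rfl fun k _ => by ring)

theorem continuous_pairCP {n : ℕ} (c : Coef n) : Continuous (pairCP c) :=
  (pairLin n c).continuous_of_finiteDimensional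

theorem pairCP_add_right {n : ℕ} (c p q : Coef n) : pairCP c (p + q) = pairCP c p + pairCP c q :=
  map_add (pairLin n c) p q

theorem pairCP_smul_right {n : ℕ} (c : Coef n) (r : ℝ) (p : Coef n) :
    pairCP c (r • p) = r * pairCP c p :=
  map_smul (pairLin n c) r p

theorem pairCP_neg_right {n : ℕ} (c p : Coef n) : pairCP c (-p) = -pairCP c p :=
  map_neg (pairLin n c) p

theorem pairCP_zero_right {n : ℕ} (c : Coef n) : pairCP c 0 = 0 :=
  map_zero (pairLin n c)

theorem exists_abs_pairCP_le {n : ℕ} (c : Coef n) : ∃ C, 0 ≤ C ∧ ∀ p, |pairCP c p| ≤ C * ‖p‖ :=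
  ⟨‖(pairLin n c).toContinuousLinearMap‖, norm_nonneg _,
    (pairLin n c).toContinuousLinearMap.le_opNorm⟩

theorem pairCP_one_zero {n : ℕ} (p : Coef n) : pairCP (1, 0) p = p.1 := by
  simp [pairCP]

/-- Every linear functional on `Coef n` is given by the pairing. -/
theorem exists_eq_pairCP {n : ℕ} (g : Coef n →ₗ[ℝ] ℝ) : ∃ V, ∀ x, g x = pairCP x V := by
  classical
  refine ⟨(g (1, 0), fun k => ⟨g (0, Pi.single k 1) / 2, g (0, Pi.single k Complex.I) / 2⟩),
    fun x => ?_⟩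
  have hx : x = x.1 • ((1, 0) : Coef n) + ∑ k : Fin n, ((x.2 k).re • ((0, Pi.single k 1) : Coef n)
      + (x.2 k).im • ((0, Pi.single k Complex.I) : Coef n)) := by
    refine Prod.ext ?_ ?_
    · simp [Prod.fst_sum]
    · ext k
      simp only [Prod.snd_add, Prod.smul_snd, Prod.snd_sum, Pi.add_apply, Pi.smul_apply,
        Finset.sum_apply, smul_zero, zero_add, Pi.single_apply, Pi.zero_apply,
        Finset.sum_add_distrib]
      simp [Complex.re_add_im]
  conv_lhs => rw [hx]
  simp only [map_add, map_smul, map_sum, smul_eq_mul, pairCP]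
  congr 1
  refine Finset.sum_congr rfl fun k _ => ?_
  simp only [Complex.mul_re, Complex.conj_re, Complex.conj_im]
  ring

/-- The vector representing evaluation at `ζ_j`. -/
def evalVec (n N : ℕ) (j : ℤ) : Coef n := (1, fun k => zet N j ^ ((k : ℕ) + 1))

theorem conj_zet (N : ℕ) (j : ℤ) : (starRingEnd ℂ) (zet N j) = (zet N j)⁻¹ := by
  rw [zet, ← Complex.exp_conj, ← Complex.exp_neg]
  congr 1
  simp only [map_div₀, map_mul, Complex.conj_ofReal, Complex.conj_I, map_intCast, map_natCast]
  ring

theorem evalR_zet {n : ℕ} (N : ℕ) (p : Coef n) (j : ℤ) :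
    evalR p (zet N j) = pairCP (evalVec n N j) p := by
  simp only [evalR, evalC, pairCP, evalVec, Complex.add_re, Complex.re_sum, Complex.ofReal_re,
    one_mul, ← conj_zet, ← map_pow]
  congr 1
  refine Finset.sum_congr rfl fun k _ => ?_
  simp only [Complex.mul_re, Complex.conj_re, Complex.conj_im]
  ring

theorem card_idxs (N : ℕ) : (idxs N).card = 2 * N := by
  rw [idxs, Int.card_Icc]
  omega

theorem sum_zet_pow {N k : ℕ} (hk : 0 < k) (hkN : k < 2 * N) :
    ∑ j ∈ idxs N, zet N j ^ k = 0 := by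
  have hN : (N : ℂ) ≠ 0 := Nat.cast_ne_zero.2 (by omega)
  have hω := Complex.isPrimitiveRoot_exp (2 * N) (by omega)
  set ω := Complex.exp (2 * Real.pi * Complex.I / (2 * N : ℕ)) with hω_def
  have hzet : ∀ j, zet N (j + 1) = zet N j * ω := fun j => by
    rw [zet, zet, hω_def, ← Complex.exp_add]
    congr 1
    push_cast
    field_simp
  have hper : zet N (N + 1) = zet N (-N + 1) := by
    rw [zet, zet, Complex.exp_eq_exp_iff_exists_int]
    refine ⟨1, ?_⟩
    push_cast
    field_simp
    ring
  have hmul : (∑ j ∈ idxs N, zet N j ^ k) * ω ^ k = ∑ j ∈ idxs N, zet N j ^ k := by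
    have h1 : (∑ j ∈ idxs N, zet N j ^ k) * ω ^ k =
        ∑ j ∈ Finset.Icc (-(N : ℤ) + 1 + 1) (N + 1), zet N j ^ k := by
      rw [Finset.sum_mul, ← Finset.map_add_right_Icc, Finset.sum_map]
      exact Finset.sum_congr rfl fun j _ => by simp [hzet, mul_pow]
    have h2 : insert (-(N : ℤ) + 1) (Finset.Icc (-(N : ℤ) + 1 + 1) (N + 1)) =
        insert ((N : ℤ) + 1) (idxs N) := by
      ext j
      simp only [idxs, Finset.mem_insert, Finset.mem_Icc]
      omega
    have h3 : ∑ j ∈ _, zet N j ^ k = ∑ j ∈ _, zet N j ^ k := Finset.sum_congr h2 fun _ _ => rfl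
    rw [Finset.sum_insert (by rw [Finset.mem_Icc]; omega),
      Finset.sum_insert (by rw [idxs, Finset.mem_Icc]; omega), hper] at h3
    rw [h1]
    exact add_left_cancel h3
  have hne : ω ^ k ≠ 1 := hω.pow_ne_one_of_pos_of_lt hk.ne' hkN
  by_contra h
  exact hne (mul_left_cancel₀ h (by rw [hmul, mul_one]))

theorem sum_evalR_zet {n N : ℕ} (hnN : n < N) (p : Coef n) :
    ∑ j ∈ idxs N, evalR p (zet N j) = 2 * N * p.1 := by
  simp only [evalR_zet, pairCP, evalVec, one_mul, Finset.sum_add_distrib, Finset.sum_const,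
    card_idxs, nsmul_eq_mul]
  rw [Finset.sum_comm]
  have : ∀ k : Fin n,
      ∑ j ∈ idxs N, 2 * (zet N j ^ ((k : ℕ) + 1) * (starRingEnd ℂ) (p.2 k)).re = 0 := fun k => by
    rw [← Finset.mul_sum, ← Complex.re_sum, ← Finset.sum_mul, sum_zet_pow (by omega) (by omega)]
    simp
  rw [Finset.sum_congr rfl fun k _ => this k]
  simp

/-! ### The cone and its dual -/

theorem isClosed_Pnn (n N : ℕ) : IsClosed (Pnn n N) := by
  simp only [Pnn, Set.ofPred_forall, evalR_zet]
  exact isClosed_iInter fun j => isClosed_iInter fun _ =>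
    isClosed_le continuous_const (continuous_pairCP _)

theorem smul_mem_Pnn {n N : ℕ} {p : Coef n} (hp : p ∈ Pnn n N) {r : ℝ} (hr : 0 ≤ r) :
    r • p ∈ Pnn n N := fun j hj => by
  rw [evalR_zet, pairCP_smul_right, ← evalR_zet]
  exact mul_nonneg hr (hp j hj)

theorem evalR_one_zero {n : ℕ} (z : ℂ) : evalR ((1, 0) : Coef n) z = 1 := by
  simp [evalR, evalC]

theorem one_zero_mem_Pnn (n N : ℕ) : ((1, 0) : Coef n) ∈ Pnn n N := fun j _ => by
  simp [evalR_one_zero]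

theorem eq_zero_of_evalR_eq_zero {n N : ℕ} {c : Coef n} (hc : c ∈ Cplus n N) {p : Coef n}
    (hp : ∀ j ∈ idxs N, evalR p (zet N j) = 0) : p = 0 := by
  by_contra h
  have h1 := hc p (fun j hj => (hp j hj).ge) h
  have h2 := hc (-p) (fun j hj => by
    rw [evalR_zet, pairCP_neg_right, ← evalR_zet, hp j hj, neg_zero]) (neg_ne_zero.2 h)
  rw [pairCP_neg_right] at h2
  linarith

/-- If the dual cone is nonempty, then it contains the constant moment sequence. -/
theorem one_zero_mem_Cplus {n N : ℕ} (hnN : n < N) {c : Coef n} (hc : c ∈ Cplus n N) :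
    ((1, 0) : Coef n) ∈ Cplus n N := fun p hp hp0 => by
  have hN : (0 : ℝ) < 2 * N := by
    have : (0 : ℝ) < N := Nat.cast_pos.2 (by omega)
    linarith
  rw [pairCP_one_zero]
  refine pos_of_mul_pos_right (b := p.1) ?_ hN.le
  rw [← sum_evalR_zet hnN]
  refine (Finset.sum_nonneg hp).lt_of_ne' fun h => hp0 ?_
  exact eq_zero_of_evalR_eq_zero hc ((Finset.sum_eq_zero_iff_of_nonneg hp).1 h)

theorem exists_pos_mul_norm_le_pairCP {n N : ℕ} {c : Coef n} (hc : c ∈ Cplus n N) :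
    ∃ ε > 0, ∀ p ∈ Pnn n N, ε * ‖p‖ ≤ pairCP c p := by
  let S := Metric.sphere (0 : Coef n) 1 ∩ Pnn n N
  have hS : IsCompact S := (isCompact_sphere _ _).inter_right (isClosed_Pnn n N)
  have hpos : ∀ p ∈ S, 0 < pairCP c p := fun p hp =>
    hc p hp.2 (ne_zero_of_mem_unit_sphere ⟨p, hp.1⟩)
  obtain ⟨ε, hε, h⟩ := hS.exists_forall_le' (continuous_pairCP c).continuousOn hpos
  refine ⟨ε, hε, fun p hp => ?_⟩
  rcases eq_or_ne p 0 with rfl | hp0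
  · simp [pairCP_zero_right]
  have hn : 0 < ‖p‖ := norm_pos_iff.2 hp0
  have := h (‖p‖⁻¹ • p) ⟨by simp [norm_smul, hn.ne'], smul_mem_Pnn hp (by positivity)⟩
  rw [pairCP_smul_right] at this
  calc ε * ‖p‖ ≤ ‖p‖⁻¹ * pairCP c p * ‖p‖ := by gcongr
    _ = pairCP c p := by field_simp

/-! ### The extended functional -/

theorem JExt_eq_coe {n N : ℕ} {c : Coef n} {m : Fin n → ℂ} {P Q : Coef n}
    (h : ∀ j ∈ idxs N, evalR Q (zet N j) = 0 → evalR P (zet N j) = 0) :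
    JExt N c m P Q = ((pairCP c Q - pairCP (0, m) P + 1 / (2 * (N : ℝ)) * ∑ j ∈ idxs N,
      evalR P (zet N j) * Real.log (evalR P (zet N j) / evalR Q (zet N j)) : ℝ) : EReal) := by
  rw [JExt, Finset.sum_congr rfl fun j hj => Jterm_eq_coe (h j hj), ← EReal.coe_finset_sum,
    ← EReal.coe_mul, ← EReal.coe_add]

theorem JExt_eq_top {n N : ℕ} {c : Coef n} {m : Fin n → ℂ} {P Q : Coef n} {j : ℤ}
    (hj : j ∈ idxs N) (hQ : evalR Q (zet N j) = 0) (hP : evalR P (zet N j) ≠ 0) :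
    JExt N c m P Q = ⊤ := by
  have hN : 0 < N := by
    rw [idxs, Finset.mem_Icc] at hj
    omega
  rw [JExt, EReal.finset_sum_eq_top (fun _ _ => Jterm_ne_bot _ _) hj (by simp [Jterm, hP, hQ]),
    EReal.coe_mul_top_of_pos (by positivity), EReal.coe_add_top]

theorem coe_le_JExt {n N : ℕ} (hnN : n < N) (c : Coef n) (m : Fin n → ℂ) {P Q : Coef n}
    (hP : P ∈ Pnn n N) (hQ : Q ∈ Pnn n N) (s : ℝ) :
    ((pairCP c Q - pairCP (0, m) P + ((s + 1) * P.1 - Q.1 * Real.exp s) : ℝ) : EReal) ≤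
      JExt N c m P Q := by
  have hN : (N : ℝ) ≠ 0 := Nat.cast_ne_zero.2 (by omega)
  have h : (s + 1) * P.1 - Q.1 * Real.exp s = 1 / (2 * (N : ℝ)) *
      ∑ j ∈ idxs N, ((s + 1) * evalR P (zet N j) - evalR Q (zet N j) * Real.exp s) := by
    rw [Finset.sum_sub_distrib, ← Finset.mul_sum, ← Finset.sum_mul, sum_evalR_zet hnN,
      sum_evalR_zet hnN]
    field_simp
  rw [h, JExt, EReal.coe_add, EReal.coe_mul, EReal.coe_finset_sum]
  refine add_le_add le_rfl (mul_le_mul_of_nonneg_left (Finset.sum_le_sum fun j hj =>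
    coe_le_Jterm (hP j hj) (hQ j hj) s) ?_)
  exact EReal.coe_nonneg.2 (by positivity)

theorem lowerSemicontinuousOn_JExt {n N : ℕ} (hN : 0 < N) (c : Coef n) (m : Fin n → ℂ) :
    LowerSemicontinuousOn (fun PQ : Coef n × Coef n => JExt N c m PQ.1 PQ.2) (DomCl n N) := by
  have hc : (0 : ℝ) < 1 / (2 * N) := by positivity
  have hbot : ∀ PQ : Coef n × Coef n,
      ∑ j ∈ idxs N, Jterm (evalR PQ.1 (zet N j)) (evalR PQ.2 (zet N j)) ≠ ⊥ := fun _ =>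
    EReal.finset_sum_ne_bot _ _ fun _ _ => Jterm_ne_bot _ _
  have hmul : Continuous fun x : EReal => ((1 / (2 * (N : ℝ)) : ℝ) : EReal) * x :=
    continuous_iff_continuousAt.2 fun x =>
      (EReal.continuousAt_mul (p := (_, x)) (.inl (EReal.coe_ne_zero.2 hc.ne'))
        (.inl (EReal.coe_ne_zero.2 hc.ne')) (.inl (EReal.coe_ne_bot _))
        (.inl (EReal.coe_ne_top _))).comp (by fun_prop)
  have hsum : LowerSemicontinuousOn (fun PQ : Coef n × Coef n =>
      ∑ j ∈ idxs N, Jterm (evalR PQ.1 (zet N j)) (evalR PQ.2 (zet N j))) (DomCl n N) := by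
    refine lowerSemicontinuousOn_finset_sum_ereal _ _ (fun j hj => ?_)
      fun j _ _ => Jterm_ne_bot _ _
    have hcont : Continuous fun PQ : Coef n × Coef n =>
        (evalR PQ.1 (zet N j), evalR PQ.2 (zet N j)) := by
      simp only [evalR_zet]
      exact ((continuous_pairCP _).comp continuous_fst).prodMk
        ((continuous_pairCP _).comp continuous_snd)
    intro x hx y hy
    have hmaps : Set.MapsTo (fun PQ : Coef n × Coef n =>
        (evalR PQ.1 (zet N j), evalR PQ.2 (zet N j))) (DomCl n N) {x | 0 ≤ x.1 ∧ 0 ≤ x.2} :=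
      fun z hz => ⟨hz.1 j hj, hz.2.2 j hj⟩
    exact (hcont.continuousWithinAt.tendsto_nhdsWithin hmaps)
      (lowerSemicontinuousOn_Jterm _ ⟨hx.1 j hj, hx.2.2 j hj⟩ y hy)
  have hlin : Continuous fun PQ : Coef n × Coef n =>
      ((pairCP c PQ.2 - pairCP ((0 : ℝ), m) PQ.1 : ℝ) : EReal) :=
    continuous_coe_real_ereal.comp (((continuous_pairCP _).comp continuous_snd).sub
      ((continuous_pairCP _).comp continuous_fst))
  refine LowerSemicontinuousOn.add' (hlin.lowerSemicontinuous.lowerSemicontinuousOn _)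
    (hmul.comp_lowerSemicontinuousOn hsum fun x y hxy =>
      mul_le_mul_of_nonneg_left hxy (EReal.coe_nonneg.2 hc.le)) fun x _ => ?_
  exact EReal.continuousAt_add (.inl (EReal.coe_ne_top _)) (.inl (EReal.coe_ne_bot _))

theorem isClosed_DomCl (n N : ℕ) : IsClosed (DomCl n N) :=
  ((isClosed_Pnn n N).preimage continuous_fst).inter <|
    (isClosed_eq (by fun_prop) continuous_const).inter <|
      (isClosed_Pnn n N).preimage continuous_snd

theorem one_zero_mem_DomCl (n N : ℕ) : (((1, 0), (1, 0)) : Coef n × Coef n) ∈ DomCl n N :=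
  ⟨one_zero_mem_Pnn n N, rfl, one_zero_mem_Pnn n N⟩

theorem JExt_one_zero_lt_top {n N : ℕ} (c : Coef n) (m : Fin n → ℂ) :
    JExt N c m (1, 0) (1, 0) < ⊤ := by
  rw [JExt_eq_coe (by simp [evalR_one_zero])]
  exact EReal.coe_lt_top _

/-- Sublevel sets of the extended functional are bounded. -/
theorem exists_norm_le_of_JExt_le {n N : ℕ} (hnN : n < N) {c : Coef n} (hc : c ∈ Cplus n N)
    (m : Fin n → ℂ) (r : ℝ) :
    ∃ R, ∀ PQ ∈ DomCl n N, JExt N c m PQ.1 PQ.2 ≤ r → ‖PQ‖ ≤ R := by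
  obtain ⟨ε, hε, hcε⟩ := exists_pos_mul_norm_le_pairCP hc
  obtain ⟨δ, hδ, h1δ⟩ := exists_pos_mul_norm_le_pairCP (one_zero_mem_Cplus hnN hc)
  obtain ⟨M, hM, hmM⟩ := exists_abs_pairCP_le ((0 : ℝ), m)
  let s := Real.log (ε / 2)
  have hs : Real.exp s = ε / 2 := Real.exp_log (by positivity)
  refine ⟨max δ⁻¹ ((r + M * δ⁻¹ - (s + 1)) / (ε / 2)), ?_⟩
  rintro ⟨P, Q⟩ ⟨hP, hP1, hQ⟩ hJ
  simp only at hP hP1 hQ hJ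
  have hPn : ‖P‖ ≤ δ⁻¹ := by
    have := h1δ P hP
    rw [pairCP_one_zero, hP1] at this
    rwa [← one_div, le_div_iff₀' hδ]
  have hle := EReal.coe_le_coe_iff.1 ((coe_le_JExt hnN c m hP hQ s).trans hJ)
  rw [hP1, hs] at hle
  have h1 := hcε Q hQ
  have h2 := (le_abs_self _).trans ((hmM P).trans (mul_le_mul_of_nonneg_left hPn hM))
  have h3 : Q.1 * (ε / 2) ≤ ‖Q‖ * (ε / 2) := by
    gcongr
    exact (le_abs_self _).trans (norm_fst_le Q)
  refine max_le_max hPn ?_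
  rw [le_div_iff₀ (by positivity)]
  simp only
  linarith

theorem exists_JExt_minimizer {n N : ℕ} (hnN : n < N) {c : Coef n} (hc : c ∈ Cplus n N)
    (m : Fin n → ℂ) :
    ∃ PQ ∈ DomCl n N, ∀ PQ' ∈ DomCl n N, JExt N c m PQ.1 PQ.2 ≤ JExt N c m PQ'.1 PQ'.2 := by
  obtain ⟨r, hr, -⟩ := EReal.lt_iff_exists_real_btwn.1 (JExt_one_zero_lt_top (N := N) c m)
  obtain ⟨R, hR⟩ := exists_norm_le_of_JExt_le hnN hc m r
  let K := Metric.closedBall (0 : Coef n × Coef n) R ∩ DomCl n N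
  have hK : IsCompact K := (isCompact_closedBall _ _).inter_right (isClosed_DomCl n N)
  have h1 : (((1, 0), (1, 0)) : Coef n × Coef n) ∈ K :=
    ⟨mem_closedBall_zero_iff.2 (hR _ (one_zero_mem_DomCl n N) hr.le), one_zero_mem_DomCl n N⟩
  obtain ⟨PQ, hPQ, hmin⟩ := LowerSemicontinuousOn.exists_isMinOn ⟨_, h1⟩ hK
    ((lowerSemicontinuousOn_JExt (by omega) c m).mono Set.inter_subset_right)
  refine ⟨PQ, hPQ.2, fun PQ' hPQ' => ?_⟩
  rcases le_or_gt (JExt N c m PQ'.1 PQ'.2) r with h | h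
  · exact hmin ⟨mem_closedBall_zero_iff.2 (hR _ hPQ' h), hPQ'⟩
  · exact (hmin h1).trans (hr.le.trans h.le)

/-! ### First order optimality -/

/-- First order condition in directions that are feasible at the active constraints. -/
theorem directional_optimality {n N : ℕ} {c : Coef n} {m : Fin n → ℂ} {P Q V : Coef n}
    (hPQ : (P, Q) ∈ DomCl n N)
    (hzero : ∀ j ∈ idxs N, evalR Q (zet N j) = 0 → evalR P (zet N j) = 0)
    (hmin : ∀ PQ' ∈ DomCl n N, JExt N c m P Q ≤ JExt N c m PQ'.1 PQ'.2)
    (hV : ∀ j ∈ idxs N, evalR Q (zet N j) = 0 → 0 ≤ evalR V (zet N j)) :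
    1 / (2 * (N : ℝ)) * ∑ j ∈ idxs N,
      evalR P (zet N j) / evalR Q (zet N j) * evalR V (zet N j) ≤ pairCP c V := by
  have heval : ∀ (t : ℝ) j, evalR (Q + t • V) (zet N j) =
      evalR Q (zet N j) + t * evalR V (zet N j) := fun t j => by
    simp only [evalR_zet, pairCP_add_right, pairCP_smul_right]
  have hpos : ∀ᶠ t : ℝ in 𝓝[>] 0, ∀ j ∈ idxs N, evalR Q (zet N j) ≠ 0 →
      0 < evalR (Q + t • V) (zet N j) := by
    refine nhdsWithin_le_nhds ((Finset.eventually_all _).2 fun j hj => ?_)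
    by_cases hQ : evalR Q (zet N j) = 0
    · simp [hQ]
    have hcont : ContinuousAt (fun t : ℝ => evalR (Q + t • V) (zet N j)) 0 := by
      simp only [heval]
      fun_prop
    have h0 : 0 < evalR (Q + (0 : ℝ) • V) (zet N j) := by
      simpa using (hPQ.2.2 j hj).lt_of_ne' hQ
    exact (hcont.eventually (lt_mem_nhds h0)).mono fun t ht _ => ht
  have hlim : Tendsto (fun t : ℝ => 1 / (2 * (N : ℝ)) * ∑ j ∈ idxs N,
      evalR P (zet N j) / evalR (Q + t • V) (zet N j) * evalR V (zet N j)) (𝓝[>] 0)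
      (𝓝 (1 / (2 * (N : ℝ)) * ∑ j ∈ idxs N,
        evalR P (zet N j) / evalR Q (zet N j) * evalR V (zet N j))) := by
    refine (tendsto_finsetSum _ fun j hj => ?_).const_mul _
    by_cases hQ : evalR Q (zet N j) = 0
    · simp [hzero j hj hQ]
    refine Tendsto.mul_const _ (Tendsto.div tendsto_const_nhds ?_ hQ)
    simp only [heval]
    refine tendsto_nhdsWithin_of_tendsto_nhds ?_
    have : ContinuousAt (fun t : ℝ => evalR Q (zet N j) + t * evalR V (zet N j)) 0 := by fun_prop
    simpa [ContinuousAt] using this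
  refine le_of_tendsto hlim ?_
  filter_upwards [hpos, self_mem_nhdsWithin] with t ht (ht0 : 0 < t)
  have hnn : Q + t • V ∈ Pnn n N := fun j hj => by
    by_cases hQ : evalR Q (zet N j) = 0
    · rw [heval, hQ, zero_add]
      exact mul_nonneg ht0.le (hV j hj hQ)
    · exact (ht j hj hQ).le
  have hzero' : ∀ j ∈ idxs N, evalR (Q + t • V) (zet N j) = 0 → evalR P (zet N j) = 0 :=
    fun j hj h => hzero j hj (by_contra fun hQ => (ht j hj hQ).ne' h)
  have hJ := hmin (P, Q + t • V) ⟨hPQ.1, hPQ.2.1, hnn⟩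
  simp only at hJ
  rw [JExt_eq_coe hzero, JExt_eq_coe hzero', EReal.coe_le_coe_iff, pairCP_add_right,
    pairCP_smul_right] at hJ
  have hterm : ∀ j ∈ idxs N,
      t * (evalR P (zet N j) / evalR (Q + t • V) (zet N j) * evalR V (zet N j)) ≤
      evalR P (zet N j) * Real.log (evalR P (zet N j) / evalR Q (zet N j)) -
      evalR P (zet N j) * Real.log (evalR P (zet N j) / evalR (Q + t • V) (zet N j)) := by
    intro j hj
    by_cases hP : evalR P (zet N j) = 0
    · simp [hP]
    have hQ : evalR Q (zet N j) ≠ 0 := fun h => hP (hzero j hj h)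
    have hQpos := (hPQ.2.2 j hj).lt_of_ne' hQ
    have hQt := ht j hj hQ
    have hlog := Real.log_le_sub_one_of_pos (div_pos hQpos hQt)
    rw [Real.log_div hQ hQt.ne'] at hlog
    rw [Real.log_div hP hQ, Real.log_div hP hQt.ne']
    have h1 := mul_le_mul_of_nonneg_left hlog (hPQ.1 j hj)
    have h2 : t * (evalR P (zet N j) / evalR (Q + t • V) (zet N j) * evalR V (zet N j)) =
        -(evalR P (zet N j) * (evalR Q (zet N j) / evalR (Q + t • V) (zet N j) - 1)) := by
      have h3 : t * evalR V (zet N j) = evalR (Q + t • V) (zet N j) - evalR Q (zet N j) := by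
        rw [heval]; ring
      rw [mul_comm _ (evalR V (zet N j)), ← mul_assoc, h3]
      field_simp
      ring
    linarith
  have hsum := mul_le_mul_of_nonneg_left (Finset.sum_le_sum hterm)
    (by positivity : 0 ≤ 1 / (2 * (N : ℝ)))
  rw [← Finset.mul_sum, Finset.sum_sub_distrib, mul_sub, mul_left_comm] at hsum
  refine le_of_mul_le_mul_left ?_ ht0
  linarith

theorem momCond_of_sum_smul_eq {n N : ℕ} {c : Coef n} {Φ : ℤ → ℝ}
    (h : ∑ j ∈ idxs N, (Φ j / (2 * N)) • evalVec n N j = c) : MomCond N c Φ := by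
  subst h
  constructor
  · simp only [dmom, zpow_zero, one_mul, Prod.fst_sum, Prod.smul_fst, evalVec, smul_eq_mul,
      mul_one, Complex.ofReal_sum, Finset.mul_sum]
    refine Finset.sum_congr rfl fun j _ => ?_
    push_cast
    ring
  · intro k
    simp only [dmom, Prod.snd_sum, Prod.smul_snd, evalVec, Finset.sum_apply, Pi.smul_apply,
      Complex.real_smul, Finset.mul_sum]
    refine Finset.sum_congr rfl fun j _ => ?_
    rw [← Nat.cast_succ, zpow_natCast, Nat.succ_eq_add_one]
    push_cast
    ring

/-- **Theorem 7, first part.** `J` attains its minimum over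
`closure(𝔓°₊(N)) × closure(𝔓₊(N))`, and every minimizing pair `(P̂,Q̂)` yields a
nonnegative `Φ̂` (equal to `P̂/Q̂` where `Q̂ > 0`) matching the covariance moments of `c`. -/
theorem cepstral_minimizer_exists_and_matches_covariances
    (n N : ℕ) (hn : 1 ≤ n) (hnN : n < N)
    (c : Coef n) (hc : c ∈ Cplus n N) (m : Fin n → ℂ) :
    (∃ PQ ∈ DomCl n N, ∀ PQ' ∈ DomCl n N,
        JExt N c m PQ.1 PQ.2 ≤ JExt N c m PQ'.1 PQ'.2) ∧
    ∀ Ph Qh : Coef n, (Ph, Qh) ∈ DomCl n N →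
      (∀ PQ' ∈ DomCl n N, JExt N c m Ph Qh ≤ JExt N c m PQ'.1 PQ'.2) →
      ∃ Φ : ℤ → ℝ, (∀ j ∈ idxs N, 0 ≤ Φ j) ∧
        (∀ j ∈ idxs N, 0 < evalR Qh (zet N j) →
          Φ j = evalR Ph (zet N j) / evalR Qh (zet N j)) ∧
        MomCond N c Φ := by
  refine ⟨exists_JExt_minimizer hnN hc m, fun P Q hPQ hmin => ?_⟩
  have hN : (N : ℝ) ≠ 0 := Nat.cast_ne_zero.2 (by omega)
  have hzero : ∀ j ∈ idxs N, evalR Q (zet N j) = 0 → evalR P (zet N j) = 0 := by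
    intro j hj hQ
    by_contra hP
    have h := (hmin _ (one_zero_mem_DomCl n N)).trans_lt (JExt_one_zero_lt_top c m)
    exact h.ne (JExt_eq_top hj hQ hP)
  let Z := (idxs N).filter fun j => evalR Q (zet N j) = 0
  obtain ⟨μ, hμ, hsum⟩ := exists_nonneg_sum_smul_eq Z (evalVec n N)
    (ContinuousLinearMap.fst ℝ ℝ (Fin n → ℂ)) (fun _ _ => rfl)
    (c - ∑ j ∈ idxs N, (phiOf N P Q j / (2 * N)) • evalVec n N j) fun g hg => by
      obtain ⟨V, hV⟩ := exists_eq_pairCP (g : Coef n →ₗ[ℝ] ℝ)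
      have hgV : ∀ j, g (evalVec n N j) = evalR V (zet N j) := fun j =>
        (hV _).trans (evalR_zet N V j).symm
      have hopt := directional_optimality hPQ hzero hmin (V := V) fun j hj hQ => by
        rw [← hgV]
        exact hg j (Finset.mem_filter.2 ⟨hj, hQ⟩)
      have hgc : g c = pairCP c V := hV c
      simp only [map_sub, map_sum, map_smul, smul_eq_mul, hgc, hgV, phiOf]
      rw [Finset.mul_sum] at hopt
      refine sub_nonneg.2 (le_trans (le_of_eq (Finset.sum_congr rfl fun j _ => ?_)) hopt)
      ring
  refine ⟨fun j => if evalR Q (zet N j) = 0 then 2 * N * μ j else phiOf N P Q j,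
    fun j hj => ?_, fun j _ hQ => ?_, momCond_of_sum_smul_eq ?_⟩
  · dsimp only
    split_ifs
    · have := hμ j
      positivity
    · exact div_nonneg (hPQ.1 j hj) (hPQ.2.2 j hj)
  · simp only [hQ.ne', if_false, phiOf]
  · rw [← sub_add_cancel c (∑ j ∈ idxs N, (phiOf N P Q j / (2 * N)) • evalVec n N j), ← hsum,
      Finset.sum_filter, ← Finset.sum_add_distrib]
    refine Finset.sum_congr rfl fun j _ => ?_
    split_ifs with hQ
    · simp [phiOf, hQ, mul_div_cancel_left₀ (μ j) (mul_ne_zero two_ne_zero hN)]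
    · rw [zero_add]
end
end

section
/- Let P ∈ 𝔓_+(N). Then the moment map F^P : 𝔓_+(N) → ℭ_+(N) is proper: for every compact subset K of ℭ_+(N), the inverse image (F^P)^{-1}(K) = {Q ∈ 𝔓_+(N) : F^P(Q) ∈ K} is compact. -/
open Complex Finset Filter Topology

noncomputable section

theorem inv_zet (N : ℕ) (j : ℤ) : (zet N j)⁻¹ = (starRingEnd ℂ) (zet N j) := by
  rw [zet, ← Complex.exp_neg, ← Complex.exp_conj]
  congr 1
  simp [neg_div]

theorem evalR_zet_s14 {n : ℕ} (N : ℕ) (p : Coef n) (j : ℤ) :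
    evalR p (zet N j) =
      p.1 + ∑ k : Fin n, 2 * (zet N j ^ ((k : ℕ) + 1) * (starRingEnd ℂ) (p.2 k)).re := by
  rw [evalR, evalC, inv_zet, Complex.add_re, Complex.ofReal_re, Complex.re_sum]
  congr 1
  refine Finset.sum_congr rfl fun k _ => ?_
  rw [← map_pow]
  simp only [Complex.add_re, Complex.mul_re, Complex.conj_re, Complex.conj_im]
  ring

theorem evalR_smul_zet {n : ℕ} (N : ℕ) (a : ℝ) (p : Coef n) (j : ℤ) :
    evalR (a • p) (zet N j) = a * evalR p (zet N j) := by
  simp only [evalR_zet_s14, mul_add, Finset.mul_sum, Prod.smul_fst, Prod.smul_snd, Pi.smul_apply,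
    smul_eq_mul]
  congr 1
  refine Finset.sum_congr rfl fun k _ => ?_
  simp [Complex.mul_re]
  ring

theorem pairCP_smul {n : ℕ} (c : Coef n) (a : ℝ) (p : Coef n) :
    pairCP c (a • p) = a * pairCP c p := by
  simp only [pairCP, mul_add, Finset.mul_sum, Prod.smul_fst, Prod.smul_snd, Pi.smul_apply,
    smul_eq_mul]
  congr 1
  · ring
  refine Finset.sum_congr rfl fun k _ => ?_
  simp [Complex.mul_re]
  ring

theorem continuous_evalR {n : ℕ} (N : ℕ) (j : ℤ) :
    Continuous fun p : Coef n => evalR p (zet N j) := by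
  simp only [evalR_zet_s14]
  fun_prop

theorem continuous_pairCP_s14 {n : ℕ} :
    Continuous fun x : Coef n × Coef n => pairCP x.1 x.2 := by
  unfold pairCP
  fun_prop

theorem dmom_mul_re (N : ℕ) (Φ : ℤ → ℝ) (k : ℤ) (w : ℂ) :
    (dmom N Φ k * w).re = 1 / (2 * (N : ℝ)) * ∑ j ∈ idxs N, Φ j * (zet N j ^ k * w).re := by
  have h : dmom N Φ k * w =
      ((1 / (2 * (N : ℝ)) : ℝ) : ℂ) * ∑ j ∈ idxs N, (Φ j : ℂ) * (zet N j ^ k * w) := by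
    rw [dmom, mul_assoc, Finset.sum_mul]
    push_cast
    congr 1
    exact Finset.sum_congr rfl fun j _ => by ring
  rw [h, Complex.re_ofReal_mul, Complex.re_sum]
  simp only [Complex.re_ofReal_mul]

theorem Fmap_fst {n : ℕ} (N : ℕ) (P Q : Coef n) :
    (Fmap N P Q).1 = 1 / (2 * (N : ℝ)) * ∑ j ∈ idxs N, phiOf N P Q j := by
  simpa [Fmap] using dmom_mul_re N (phiOf N P Q) 0 1

theorem pairCP_Fmap {n : ℕ} (N : ℕ) (P Q R : Coef n) :
    pairCP (Fmap N P Q) R =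
      1 / (2 * (N : ℝ)) * ∑ j ∈ idxs N, phiOf N P Q j * evalR R (zet N j) := by
  rw [pairCP, Fmap_fst]
  simp only [Fmap, dmom_mul_re, evalR_zet_s14, mul_add, Finset.sum_add_distrib, Finset.mul_sum,
    Finset.sum_mul]
  congr 1
  · exact Finset.sum_congr rfl fun j _ => by ring
  rw [Finset.sum_comm]
  refine Finset.sum_congr rfl fun j _ => Finset.sum_congr rfl fun k _ => ?_
  norm_cast
  ring

theorem pairCP_Fmap_self {n : ℕ} (N : ℕ) (P : Coef n) {Q : Coef n} (hQ : Q ∈ Pplus n N) :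
    pairCP (Fmap N P Q) Q = 1 / (2 * (N : ℝ)) * ∑ j ∈ idxs N, evalR P (zet N j) := by
  rw [pairCP_Fmap]
  congr 1
  exact Finset.sum_congr rfl fun j hj => div_mul_cancel₀ _ (hQ j hj).ne'

theorem continuousOn_Fmap {n : ℕ} (N : ℕ) (P : Coef n) :
    ContinuousOn (Fmap N P) (Pplus n N) := by
  have hφ : ∀ j ∈ idxs N, ContinuousOn (fun Q => phiOf N P Q j) (Pplus n N) := fun j hj =>
    continuousOn_const.div (continuous_evalR N j).continuousOn fun Q hQ => (hQ j hj).ne'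
  have hd : ∀ k : ℤ, ContinuousOn (fun Q => dmom N (phiOf N P Q) k) (Pplus n N) := fun k =>
    continuousOn_const.mul <| continuousOn_finsetSum _ fun j hj =>
      continuousOn_const.mul (Complex.continuous_ofReal.comp_continuousOn (hφ j hj))
  exact (Complex.continuous_re.comp_continuousOn (hd 0)).prodMk
    (continuousOn_pi.2 fun k => hd _)

/-- A compact set of functionals in the open dual cone is uniformly coercive on the cone. -/
theorem exists_mul_norm_le_pairCP {n N : ℕ} {K : Set (Coef n)} (hK : IsCompact K)
    (hKC : K ⊆ Cplus n N) :
    ∃ ε > 0, ∀ c ∈ K, ∀ Q ∈ Pnn n N, ε * ‖Q‖ ≤ pairCP c Q := by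
  have hcl : IsClosed (Pnn n N) := by
    simp only [Pnn, Set.ofPred_forall]
    exact isClosed_biInter fun j _ => isClosed_le continuous_const (continuous_evalR N j)
  have hS : IsCompact (K ×ˢ (Metric.sphere (0 : Coef n) 1 ∩ Pnn n N)) :=
    hK.prod ((isCompact_sphere _ _).inter_right hcl)
  obtain ⟨ε, hε, h⟩ := hS.exists_forall_le' continuous_pairCP_s14.continuousOn (a := 0) <| by
    rintro ⟨c, q⟩ ⟨hc, hq, hqn⟩
    exact hKC hc q hqn (ne_zero_of_mem_unit_sphere ⟨q, hq⟩)
  refine ⟨ε, hε, fun c hc Q hQ => ?_⟩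
  rcases eq_or_ne Q 0 with rfl | h0
  · simp [pairCP]
  have hpos : 0 < ‖Q‖ := norm_pos_iff.2 h0
  have hmem : ‖Q‖⁻¹ • Q ∈ Metric.sphere (0 : Coef n) 1 ∩ Pnn n N := by
    refine ⟨?_, fun j hj => ?_⟩
    · simp [norm_smul, hpos.ne']
    · rw [evalR_smul_zet]
      exact mul_nonneg (inv_nonneg.2 hpos.le) (hQ j hj)
  have := h (c, ‖Q‖⁻¹ • Q) ⟨hc, hmem⟩
  rw [pairCP_smul, inv_mul_eq_div, le_div_iff₀ hpos] at this
  exact this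

/-- A bound on the zeroth moment keeps `Q` away from the boundary of the cone. -/
theorem evalR_le_of_Fmap_fst_le {n N : ℕ} (hN : 0 < N) {P Q : Coef n} (hP : P ∈ Pplus n N)
    (hQ : Q ∈ Pplus n N) {B : ℝ} (hB : (Fmap N P Q).1 ≤ B) {j : ℤ} (hj : j ∈ idxs N) :
    evalR P (zet N j) ≤ 2 * N * B * evalR Q (zet N j) := by
  have hN' : (0 : ℝ) < 2 * N := by positivity
  rw [Fmap_fst, one_div, inv_mul_le_iff₀ hN'] at hB
  rw [← div_le_iff₀ (hQ j hj)]
  exact (Finset.single_le_sum (f := phiOf N P Q)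
    (fun i hi => (div_pos (hP i hi) (hQ i hi)).le) hj).trans hB

/-- **Lemma 10.** For `P ∈ 𝔓₊(N)`, the moment map
`F^P : 𝔓₊(N) → ℭ₊(N)` is proper: inverse images of compact subsets of `ℭ₊(N)`
are compact. -/
theorem Fmap_proper
    (n N : ℕ) (hn : 1 ≤ n) (hnN : n < N) (P : Coef n) (hP : P ∈ Pplus n N)
    (K : Set (Coef n)) (hK : IsCompact K) (hKC : K ⊆ Cplus n N) :
    IsCompact {Q : Coef n | Q ∈ Pplus n N ∧ Fmap N P Q ∈ K} := by
  have hN : 0 < N := by omega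
  obtain ⟨ε, hε, hcoer⟩ := exists_mul_norm_le_pairCP hK hKC
  obtain ⟨B, hB⟩ := hK.isBounded.exists_norm_le
  have hB1 : ∀ c ∈ K, c.1 ≤ B := fun c hc =>
    (le_abs_self _).trans ((norm_fst_le c).trans (hB c hc))
  let T : Set (Coef n) :=
    {Q | ∀ j ∈ idxs N, evalR P (zet N j) ≤ 2 * N * |B| * evalR Q (zet N j)}
  have hT : IsClosed T := by
    simp only [T, Set.ofPred_forall]
    exact isClosed_biInter fun j _ =>
      isClosed_le continuous_const (continuous_const.mul (continuous_evalR N j))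
  have hTP : T ⊆ Pplus n N := fun Q hQ j hj =>
    pos_of_mul_pos_right ((hP j hj).trans_le (hQ j hj)) (by positivity)
  have hEq : {Q : Coef n | Q ∈ Pplus n N ∧ Fmap N P Q ∈ K} = T ∩ Fmap N P ⁻¹' K := by
    ext Q
    exact ⟨fun ⟨hQ, hF⟩ => ⟨fun j hj =>
      evalR_le_of_Fmap_fst_le hN hP hQ ((hB1 _ hF).trans (le_abs_self B)) hj, hF⟩,
      fun ⟨hQ, hF⟩ => ⟨hTP hQ, hF⟩⟩
  refine Metric.isCompact_of_isClosed_isBounded ?_ ?_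
  · rw [hEq]
    exact ((continuousOn_Fmap N P).mono hTP).preimage_isClosed_of_isClosed hT hK.isClosed
  · refine isBounded_iff_forall_norm_le.2
      ⟨(1 / (2 * (N : ℝ)) * ∑ j ∈ idxs N, evalR P (zet N j)) / ε, fun Q ⟨hQ, hF⟩ => ?_⟩
    rw [le_div_iff₀' hε, ← pairCP_Fmap_self N P hQ]
    exact hcoer _ hF Q fun j hj => (hQ j hj).le
end
end

section
/- Let c = (c_0, …, c_n) with c_0 real and c_1, …, c_n complex, and let T_n be the (n+1)×(n+1) Hermitian Toeplitz matrix with (j,k) entry c_{k−j} (where c_{-m} := conj(c_m)). Then c ∈ ℭ_+ if and only if T_n is positive definite. -/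
open Complex Finset Filter Topology

noncomputable section

/-- The extended covariance sequence: `cIdx c k = c_k` for `0 ≤ k ≤ n`,
`cIdx c (−k) = conj c_k`, and `0` for `|k| > n`. -/
def cIdx {n : ℕ} (c : Coef n) (k : ℤ) : ℂ :=
  if k = 0 then (c.1 : ℂ)
  else if h2 : 0 < k ∧ k ≤ (n : ℤ) then c.2 ⟨k.toNat - 1, by omega⟩
  else if h3 : 0 < -k ∧ -k ≤ (n : ℤ) then (starRingEnd ℂ) (c.2 ⟨(-k).toNat - 1, by omega⟩)
  else 0

open scoped ComplexOrder InnerProductSpace Matrix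

section Coefficients

variable {n : ℕ}

@[simp]
lemma cIdx_zero (c : Coef n) : cIdx c 0 = (c.1 : ℂ) := by
  simp [cIdx]

@[simp]
lemma cIdx_succ (c : Coef n) (m : Fin n) : cIdx c ((m : ℤ) + 1) = c.2 m := by
  have h0 : ((m : ℤ) + 1) ≠ 0 := by omega
  have h1 : 0 < ((m : ℤ) + 1) ∧ ((m : ℤ) + 1) ≤ (n : ℤ) := by omega
  rw [cIdx, if_neg h0, dif_pos h1]
  congr 1

lemma cIdx_neg_succ (c : Coef n) (m : Fin n) :
    cIdx c (-((m : ℤ) + 1)) = (starRingEnd ℂ) (c.2 m) := by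
  have h0 : -((m : ℤ) + 1) ≠ 0 := by omega
  have h1 : ¬ (0 < -((m : ℤ) + 1) ∧ -((m : ℤ) + 1) ≤ (n : ℤ)) := by omega
  have h2 : 0 < - -((m : ℤ) + 1) ∧ - -((m : ℤ) + 1) ≤ (n : ℤ) := by omega
  rw [cIdx, if_neg h0, dif_neg h1, dif_pos h2]
  congr 2

/-- An integer in `[-n, n]` is `0`, `m + 1` or `-(m + 1)` with `m < n`. -/
lemma exists_fin_of_abs_le {d : ℤ} (hd : |d| ≤ n) :
    d = 0 ∨ ∃ m : Fin n, d = (m : ℤ) + 1 ∨ d = -((m : ℤ) + 1) := by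
  rw [abs_le] at hd
  rcases lt_trichotomy d 0 with h | h | h
  · exact Or.inr ⟨⟨(-d - 1).toNat, by omega⟩, Or.inr (by simp only; omega)⟩
  · exact Or.inl h
  · exact Or.inr ⟨⟨(d - 1).toNat, by omega⟩, Or.inl (by simp only; omega)⟩

lemma abs_fin_sub_le (j k : Fin (n + 1)) : |(k : ℤ) - (j : ℤ)| ≤ n := by
  rw [abs_le]; omega

lemma cIdx_neg (c : Coef n) {d : ℤ} (hd : |d| ≤ n) :
    cIdx c (-d) = (starRingEnd ℂ) (cIdx c d) := by
  rcases exists_fin_of_abs_le hd with rfl | ⟨m, rfl | rfl⟩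
  · simp
  · rw [cIdx_neg_succ, cIdx_succ]
  · rw [neg_neg, cIdx_neg_succ, cIdx_succ, Complex.conj_conj]

lemma cIdx_sub_smul (c p : Coef n) (ε : ℝ) {d : ℤ} (hd : |d| ≤ n) :
    cIdx (c - ε • p) d = cIdx c d - ε * cIdx p d := by
  rcases exists_fin_of_abs_le hd with rfl | ⟨m, rfl | rfl⟩ <;>
    simp [cIdx_neg_succ, -neg_add_rev]

lemma pairCP_sub_smul (c p q : Coef n) (ε : ℝ) :
    pairCP (c - ε • p) q = pairCP c q - ε * pairCP p q := by
  simp only [pairCP, Prod.fst_sub, Prod.snd_sub, Prod.smul_fst, Prod.smul_snd, Pi.sub_apply,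
    Pi.smul_apply, smul_eq_mul, Complex.real_smul]
  rw [mul_add, Finset.mul_sum, add_sub_add_comm, ← Finset.sum_sub_distrib]
  congr 1
  · ring
  · refine Finset.sum_congr rfl fun k _ => ?_
    rw [sub_mul, Complex.sub_re, mul_assoc, Complex.re_ofReal_mul]
    ring

lemma pairCP_self_pos {p : Coef n} (hp : p ≠ 0) : 0 < pairCP p p := by
  have hterm (k : Fin n) : 2 * (p.2 k * (starRingEnd ℂ) (p.2 k)).re = 2 * ‖p.2 k‖ ^ 2 := by
    rw [Complex.mul_conj, Complex.ofReal_re, Complex.normSq_eq_norm_sq]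
  simp only [pairCP, hterm]
  have hs : 0 ≤ ∑ k : Fin n, 2 * ‖p.2 k‖ ^ 2 := Finset.sum_nonneg fun k _ => by positivity
  rcases eq_or_ne p.1 0 with h1 | h1
  · have h2 : p.2 ≠ 0 := fun h2 => hp (Prod.ext h1 h2)
    obtain ⟨k, hk⟩ := Function.ne_iff.mp h2
    have : 0 < ∑ k : Fin n, 2 * ‖p.2 k‖ ^ 2 := by
      refine Finset.sum_pos' (fun k _ => by positivity) ⟨k, Finset.mem_univ k, ?_⟩
      have := norm_pos_iff.mpr hk
      positivity
    nlinarith [mul_self_nonneg p.1]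
  · have := mul_self_pos.mpr h1
    linarith

end Coefficients

section Toeplitz

variable {n : ℕ}

/-- The Hermitian Toeplitz matrix with `(j, k)` entry `c_{k-j}`. -/
def toeplitz (c : Coef n) : Matrix (Fin (n + 1)) (Fin (n + 1)) ℂ :=
  Matrix.of fun j k => cIdx c ((k : ℤ) - (j : ℤ))

lemma toeplitz_isHermitian (c : Coef n) : (toeplitz c).IsHermitian := by
  ext j k
  simp only [toeplitz, Matrix.conjTranspose_apply, Matrix.of_apply]
  rw [← neg_sub, cIdx_neg c (abs_fin_sub_le j k)]
  simp

lemma toeplitz_sub_smul (c p : Coef n) (ε : ℝ) :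
    toeplitz (c - ε • p) = toeplitz c - (ε : ℂ) • toeplitz p := by
  ext j k
  simp [toeplitz, cIdx_sub_smul c p ε (abs_fin_sub_le j k)]

/-- The coefficients of the trigonometric polynomial `|∑ j, x j * z ^ j| ^ 2`. -/
def normSqCoef (x : Fin (n + 1) → ℂ) : Coef n :=
  (∑ j, ‖x j‖ ^ 2, fun m => ∑ j : Fin (n + 1), ∑ k : Fin (n + 1),
    if (k : ℤ) - (j : ℤ) = (m : ℤ) + 1 then x j * (starRingEnd ℂ) (x k) else 0)

/-- Grouping the terms of a Toeplitz form along the diagonals. -/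
lemma sum_toeplitz_form (f : ℤ → ℂ) (x : Fin (n + 1) → ℂ) :
    ∑ j : Fin (n + 1), ∑ k : Fin (n + 1),
        (starRingEnd ℂ) (x j) * x k * f ((k : ℤ) - (j : ℤ)) =
      f 0 * ((normSqCoef x).1 : ℂ) + ∑ m : Fin n,
        (f ((m : ℤ) + 1) * (starRingEnd ℂ) ((normSqCoef x).2 m)
          + f (-((m : ℤ) + 1)) * (normSqCoef x).2 m) := by
  have hsplit (j k : Fin (n + 1)) : f ((k : ℤ) - (j : ℤ)) =
      (if j = k then f 0 else 0) + ∑ m : Fin n,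
        ((if (k : ℤ) - (j : ℤ) = (m : ℤ) + 1 then f ((m : ℤ) + 1) else 0)
          + (if (j : ℤ) - (k : ℤ) = (m : ℤ) + 1 then f (-((m : ℤ) + 1)) else 0)) := by
    rcases exists_fin_of_abs_le (abs_fin_sub_le j k) with h | ⟨m, h | h⟩
    · have hjk : j = k := by ext; omega
      subst hjk
      rw [Finset.sum_eq_zero]
      · simp
      · intro m _
        rw [if_neg (by omega), if_neg (by omega), add_zero]
    · rw [Finset.sum_eq_single m, if_neg (by rintro rfl; omega), if_pos h, if_neg (by omega), h]
      · simp
      · intro m' _ hm'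
        have : (m' : ℤ) ≠ m := by exact_mod_cast Fin.val_ne_of_ne hm'
        rw [if_neg (by omega), if_neg (by omega), add_zero]
      · simp
    · rw [Finset.sum_eq_single m, if_neg (by rintro rfl; omega), if_neg (by omega),
        if_pos (by omega), h]
      · simp
      · intro m' _ hm'
        have : (m' : ℤ) ≠ m := by exact_mod_cast Fin.val_ne_of_ne hm'
        rw [if_neg (by omega), if_neg (by omega), add_zero]
      · simp
  have hdiag : f 0 * ((normSqCoef x).1 : ℂ) =
      ∑ j : Fin (n + 1), ∑ k : Fin (n + 1),
        (starRingEnd ℂ) (x j) * x k * (if j = k then f 0 else 0) := by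
    simp only [normSqCoef, mul_ite, mul_zero, Finset.sum_ite_eq, Finset.mem_univ, if_true]
    push_cast
    rw [Finset.mul_sum]
    refine Finset.sum_congr rfl fun j _ => ?_
    rw [Complex.conj_mul', mul_comm]
  have hup (m : Fin n) : f ((m : ℤ) + 1) * (starRingEnd ℂ) ((normSqCoef x).2 m) =
      ∑ j : Fin (n + 1), ∑ k : Fin (n + 1), (starRingEnd ℂ) (x j) * x k *
        (if (k : ℤ) - (j : ℤ) = (m : ℤ) + 1 then f ((m : ℤ) + 1) else 0) := by
    simp only [normSqCoef, map_sum, Finset.mul_sum]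
    refine Finset.sum_congr rfl fun j _ => Finset.sum_congr rfl fun k _ => ?_
    split_ifs
    · simp only [map_mul, Complex.conj_conj]; ring
    · simp
  have hdown (m : Fin n) : f (-((m : ℤ) + 1)) * (normSqCoef x).2 m =
      ∑ j : Fin (n + 1), ∑ k : Fin (n + 1), (starRingEnd ℂ) (x j) * x k *
        (if (j : ℤ) - (k : ℤ) = (m : ℤ) + 1 then f (-((m : ℤ) + 1)) else 0) := by
    rw [Finset.sum_comm]
    simp only [normSqCoef, Finset.mul_sum]
    refine Finset.sum_congr rfl fun j _ => Finset.sum_congr rfl fun k _ => ?_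
    split_ifs
    · ring
    · simp
  rw [hdiag]
  simp_rw [hup, hdown, hsplit, mul_add, Finset.mul_sum, mul_add, Finset.sum_add_distrib]
  congr 2 <;>
  · rw [Finset.sum_comm]
    conv_lhs => rw [Finset.sum_comm]
    conv_rhs => rw [Finset.sum_comm]
    refine Finset.sum_congr rfl fun j _ => ?_
    rw [Finset.sum_comm]

/-- The Toeplitz form at `x` is the pairing with `|∑ j, x j * z ^ j| ^ 2`. -/
lemma star_dotProduct_toeplitz_mulVec (c : Coef n) (x : Fin (n + 1) → ℂ) :
    star x ⬝ᵥ (toeplitz c *ᵥ x) = (pairCP c (normSqCoef x) : ℂ) := by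
  have h : star x ⬝ᵥ (toeplitz c *ᵥ x) = ∑ j : Fin (n + 1), ∑ k : Fin (n + 1),
      (starRingEnd ℂ) (x j) * x k * cIdx c ((k : ℤ) - (j : ℤ)) := by
    simp only [dotProduct, Matrix.mulVec, toeplitz, Matrix.of_apply, Pi.star_apply,
      Finset.mul_sum, starRingEnd_apply]
    refine Finset.sum_congr rfl fun j _ => Finset.sum_congr rfl fun k _ => ?_
    ring
  rw [h, sum_toeplitz_form (cIdx c) x, pairCP]
  push_cast
  rw [cIdx_zero]
  congr 1
  refine Finset.sum_congr rfl fun m _ => ?_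
  rw [cIdx_succ, cIdx_neg_succ, ← Complex.ofReal_ofNat, ← Complex.ofReal_mul,
    ← Complex.add_conj]
  simp

lemma evalC_normSqCoef (x : Fin (n + 1) → ℂ) {z : ℂ} (hz : ‖z‖ = 1) :
    evalC (normSqCoef x) z = ((‖∑ k : Fin (n + 1), x k * z ^ (k : ℕ)‖ ^ 2 : ℝ) : ℂ) := by
  have hz0 : z ≠ 0 := norm_ne_zero_iff.mp (by rw [hz]; exact one_ne_zero)
  have hconj : (starRingEnd ℂ) z = z⁻¹ := (Complex.inv_eq_conj hz).symm
  push_cast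
  rw [← Complex.conj_mul', map_sum, Finset.sum_mul_sum]
  trans ∑ j : Fin (n + 1), ∑ k : Fin (n + 1),
      (starRingEnd ℂ) (x j) * x k * z ^ ((k : ℤ) - (j : ℤ))
  · rw [sum_toeplitz_form (fun d => z ^ d) x, evalC, zpow_zero, one_mul]
    congr 1
    refine Finset.sum_congr rfl fun m _ => ?_
    have h1 : z ^ ((m : ℤ) + 1) = z ^ ((m : ℕ) + 1) := by exact_mod_cast zpow_natCast z (m + 1)
    rw [zpow_neg, h1, inv_pow]
    ring
  · refine Finset.sum_congr rfl fun j _ => Finset.sum_congr rfl fun k _ => ?_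
    rw [zpow_sub₀ hz0, zpow_natCast, zpow_natCast, map_mul, map_pow, hconj, inv_pow]
    field_simp

lemma normSqCoef_mem_PnnC (x : Fin (n + 1) → ℂ) : normSqCoef x ∈ PnnC n := by
  intro θ _
  rw [evalR, evalC_normSqCoef x (Complex.norm_exp_ofReal_mul_I θ), Complex.ofReal_re]
  positivity

lemma normSqCoef_ne_zero {x : Fin (n + 1) → ℂ} (hx : x ≠ 0) : normSqCoef x ≠ 0 := by
  obtain ⟨k, hk⟩ := Function.ne_iff.mp hx
  have : 0 < (normSqCoef x).1 := by
    refine Finset.sum_pos' (fun k _ => by positivity) ⟨k, Finset.mem_univ k, ?_⟩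
    have := norm_pos_iff.mpr hk
    positivity
  intro h
  simp [h] at this

end Toeplitz

/-- A small Hermitian perturbation of a positive definite matrix is positive definite. -/
lemma Matrix.PosDef.exists_sub_smul {ι : Type*} [Fintype ι] {A B : Matrix ι ι ℂ}
    (hA : A.PosDef) (hB : B.IsHermitian) :
    ∃ ε : ℝ, 0 < ε ∧ (A - (ε : ℂ) • B).PosDef := by
  have hcont : Continuous fun q : ℝ × (ι → ℂ) =>
      (star q.2 ⬝ᵥ ((A - (q.1 : ℂ) • B) *ᵥ q.2)).re := by fun_prop
  have hev : ∀ᶠ ε : ℝ in 𝓝 0, ∀ x ∈ Metric.sphere (0 : ι → ℂ) 1,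
      0 < (star x ⬝ᵥ ((A - (ε : ℂ) • B) *ᵥ x)).re := by
    refine (isCompact_sphere _ _).eventually_forall_of_forall_eventually fun x hx => ?_
    refine hcont.continuousAt.eventually (lt_mem_nhds ?_)
    have hx0 : x ≠ 0 := by
      rintro rfl
      simp at hx
    simpa using (Complex.pos_iff.mp (hA.dotProduct_mulVec_pos hx0)).1
  obtain ⟨ε, hε, hε0⟩ := ((hev.filter_mono nhdsWithin_le_nhds).and
    (self_mem_nhdsWithin : Set.Ioi (0 : ℝ) ∈ 𝓝[>] 0)).exists
  have hherm : (A - (ε : ℂ) • B).IsHermitian := by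
    refine hA.isHermitian.sub ?_
    ext i j
    simp [← hB.apply i j]
  refine ⟨ε, hε0, .of_dotProduct_mulVec_pos hherm fun x hx => ?_⟩
  have him : (star x ⬝ᵥ ((A - (ε : ℂ) • B) *ᵥ x)).im = 0 := hherm.im_star_dotProduct_mulVec_self x
  refine Complex.pos_iff.mpr ⟨?_, him.symm⟩
  have hnx : 0 < ‖x‖ := norm_pos_iff.mpr hx
  have hs := hε (((‖x‖⁻¹ : ℝ) : ℂ) • x) (by
    simp [norm_smul, hnx.ne'])
  rw [star_smul, Matrix.mulVec_smul, smul_dotProduct, dotProduct_smul, smul_eq_mul, smul_eq_mul,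
    Complex.star_def, Complex.conj_ofReal, Complex.re_ofReal_mul, Complex.re_ofReal_mul] at hs
  have hi : 0 < ‖x‖⁻¹ := inv_pos.mpr hnx
  exact pos_of_mul_pos_right (pos_of_mul_pos_right hs hi.le) hi.le

/-- A positive semidefinite complex matrix is a Gram matrix. -/
lemma Matrix.PosSemidef.exists_gram_eq {ι : Type*} [Fintype ι] {A : Matrix ι ι ℂ}
    (hA : A.PosSemidef) : ∃ v : ι → EuclideanSpace ℂ ι, Matrix.gram ℂ v = A := by
  classical
  open scoped MatrixOrder Matrix.Norms.L2Operator in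
  obtain ⟨B, rfl⟩ := CStarAlgebra.nonneg_iff_eq_star_mul_self.mp hA.nonneg
  refine ⟨fun i => WithLp.toLp 2 (fun k => B k i), ?_⟩
  ext i j
  simp [Matrix.gram_apply, PiLp.inner_apply, Matrix.mul_apply, Matrix.star_apply, mul_comm]

/-- Two families with the same Gram matrix, the first linearly independent, are related by
a unitary operator. -/
lemma exists_unitary_of_gram_eq {ι V : Type*} [Fintype ι] [NormedAddCommGroup V]
    [InnerProductSpace ℂ V] [FiniteDimensional ℂ V] [CompleteSpace V] {v w : ι → V}
    (hv : LinearIndependent ℂ v) (h : Matrix.gram ℂ v = Matrix.gram ℂ w) :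
    ∃ U ∈ unitary (V →L[ℂ] V), ∀ i, U (v i) = w i := by
  let b := Module.Basis.span hv
  have hbv (i : ι) : (b i : V) = v i := congrArg Subtype.val (Module.Basis.span_apply hv i)
  let L : Submodule.span ℂ (Set.range v) →ₗ[ℂ] V := b.constr ℂ w
  have hL (x : Submodule.span ℂ (Set.range v)) : ‖L x‖ = ‖x‖ := by
    have h1 : L x = ∑ i, b.repr x i • w i := b.constr_apply_fintype ℂ w x
    have h2 : (x : V) = ∑ i, b.repr x i • v i := by
      have := congrArg Subtype.val (b.sum_repr x)
      simpa only [Submodule.coe_sum, Submodule.coe_smul, hbv] using this.symm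
    have h3 : ⟪L x, L x⟫_ℂ = ⟪(x : V), (x : V)⟫_ℂ := by
      rw [h1, h2, ← Matrix.star_dotProduct_gram_mulVec w, ← Matrix.star_dotProduct_gram_mulVec v, h]
    rw [@norm_eq_sqrt_re_inner ℂ, h3, ← @norm_eq_sqrt_re_inner ℂ, Submodule.coe_norm]
  let E : V ≃ₗᵢ[ℂ] V := (LinearIsometry.extend ⟨L, hL⟩).toLinearIsometryEquiv rfl
  refine ⟨(Unitary.linearIsometryEquiv.symm E : V →L[ℂ] V), SetLike.coe_mem _, fun i => ?_⟩
  have h1 : LinearIsometry.extend ⟨L, hL⟩ (b i : V) = L (b i) :=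
    LinearIsometry.extend_apply ⟨L, hL⟩ (b i)
  have h2 : L (b i) = w i := b.constr_basis ℂ w i
  rw [← hbv i, ← h2, ← h1]
  rfl

/-- A trigonometric polynomial nonnegative on the circle is positive at a unitary operator. -/
lemma nonneg_trigPolynomial_unitary {n : ℕ} {A : Type*} [CStarAlgebra A] [PartialOrder A]
    [StarOrderedRing A] {U : A} (hU : U ∈ unitary A) {p : Coef n} (hp : p ∈ PnnC n) :
    0 ≤ algebraMap ℂ A (p.1 : ℂ) + ∑ k : Fin n,
      (p.2 k • star U ^ ((k : ℕ) + 1) + (starRingEnd ℂ) (p.2 k) • U ^ ((k : ℕ) + 1)) := by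
  have hn : IsStarNormal U := isStarNormal_of_mem_unitary hU
  let F : Fin n → ℂ → ℂ := fun k z =>
    p.2 k • star z ^ ((k : ℕ) + 1) + (starRingEnd ℂ) (p.2 k) • z ^ ((k : ℕ) + 1)
  have hF (k : Fin n) : Continuous (F k) := by fun_prop
  have hcfc : cfc (fun z : ℂ => (p.1 : ℂ) + (∑ k, F k) z) U =
      algebraMap ℂ A (p.1 : ℂ) + ∑ k : Fin n,
      (p.2 k • star U ^ ((k : ℕ) + 1) + (starRingEnd ℂ) (p.2 k) • U ^ ((k : ℕ) + 1)) := by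
    rw [cfc_const_add _ _ _ (by
      rw [show (∑ k, F k) = fun z => ∑ k, F k z by ext; simp]; fun_prop),
      cfc_sum_univ F U (fun k => (hF k).continuousOn)]
    congr 1
    refine Finset.sum_congr rfl fun k _ => ?_
    rw [cfc_add U (fun z : ℂ => p.2 k • star z ^ ((k : ℕ) + 1))
      (fun z : ℂ => (starRingEnd ℂ) (p.2 k) • z ^ ((k : ℕ) + 1)) (by fun_prop) (by fun_prop),
      cfc_smul _ (fun z : ℂ => star z ^ ((k : ℕ) + 1)) U (by fun_prop),
      cfc_smul _ (fun z : ℂ => z ^ ((k : ℕ) + 1)) U (by fun_prop),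
      cfc_pow (fun z : ℂ => star z) _ U (by fun_prop), cfc_star_id (a := U), cfc_pow_id U]
  rw [← hcfc]
  refine cfc_nonneg fun z hz => ?_
  have hz1 : ‖z‖ = 1 := by
    simpa using spectrum.subset_circle_of_unitary hU hz
  have hconj : (starRingEnd ℂ) z = z⁻¹ := (Complex.inv_eq_conj hz1).symm
  have heval : (p.1 : ℂ) + (∑ k, F k) z = evalC p z := by
    simp [F, evalC, hconj]
  have hzarg : Complex.exp (Complex.arg z * Complex.I) = z := by
    have := Complex.norm_mul_exp_arg_mul_I z
    rwa [hz1, Complex.ofReal_one, one_mul] at this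
  have hre : 0 ≤ (evalC p z).re := by
    have := hp (Complex.arg z) ⟨(Complex.neg_pi_lt_arg z).le, Complex.arg_le_pi z⟩
    rwa [hzarg] at this
  have him : (evalC p z).im = 0 := by
    rw [← Complex.conj_eq_iff_im]
    simp only [evalC, map_add, map_sum, map_mul, map_pow, map_inv₀, Complex.conj_conj,
      Complex.conj_ofReal, hconj, inv_inv]
    congr 1
    exact Finset.sum_congr rfl fun k _ => add_comm _ _
  rw [heval]
  exact Complex.nonneg_iff.mpr ⟨hre, him.symm⟩

lemma pairCP_nonneg_of_posDef {n : ℕ} {c p : Coef n} (hc : (toeplitz c).PosDef)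
    (hp : p ∈ PnnC n) : 0 ≤ pairCP c p := by
  obtain ⟨v, hv⟩ := hc.posSemidef.exists_gram_eq
  have hvi : LinearIndependent ℂ v := Matrix.linearIndependent_of_posDef_gram (hv ▸ hc)
  have hinner (j k : Fin (n + 1)) : ⟪v j, v k⟫_ℂ = cIdx c ((k : ℤ) - (j : ℤ)) := by
    rw [← Matrix.gram_apply, hv]; rfl
  obtain ⟨U, hU, hUv⟩ := exists_unitary_of_gram_eq (v := v ∘ Fin.castSucc) (w := v ∘ Fin.succ)
    (hvi.comp _ (Fin.castSucc_injective n)) (by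
      ext j k
      simp [hinner])
  have hpow (k : ℕ) (hk : k < n + 1) : (U ^ k) (v 0) = v ⟨k, hk⟩ := by
    induction k with
    | zero => rfl
    | succ k ih =>
      rw [pow_succ', mul_apply_eq_comp, ih (by omega)]
      exact hUv ⟨k, by omega⟩
  have hmom (m : Fin n) : ⟪v 0, (U ^ ((m : ℕ) + 1)) (v 0)⟫_ℂ = c.2 m := by
    rw [hpow _ (by omega), hinner, ← cIdx_succ]
    simp
  have hmom' (m : Fin n) : ⟪v 0, (star U ^ ((m : ℕ) + 1)) (v 0)⟫_ℂ = (starRingEnd ℂ) (c.2 m) := by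
    rw [← star_pow, ContinuousLinearMap.star_eq_adjoint, ContinuousLinearMap.adjoint_inner_right,
      ← inner_conj_symm, hmom]
  have hpos := ((ContinuousLinearMap.nonneg_iff_isPositive _).mp
    (nonneg_trigPolynomial_unitary hU hp)).inner_nonneg_right (v 0)
  have hval : ⟪v 0, (algebraMap ℂ 
      (EuclideanSpace ℂ (Fin (n + 1)) →L[ℂ] EuclideanSpace ℂ (Fin (n + 1))) (p.1 : ℂ) +
      ∑ k : Fin n, (p.2 k • star U ^ ((k : ℕ) + 1) +
        (starRingEnd ℂ) (p.2 k) • U ^ ((k : ℕ) + 1))) (v 0)⟫_ℂ = (pairCP c p : ℂ) := by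
    have h00 : ⟪v 0, v 0⟫_ℂ = (c.1 : ℂ) := by rw [hinner]; simp
    simp only [add_apply, _root_.sum_apply,
      smul_apply, inner_add_right, inner_sum, inner_smul_right, hmom, hmom',
      Algebra.algebraMap_eq_smul_one, one_apply_eq_self, h00, pairCP]
    push_cast
    congr 1
    · ring
    · refine Finset.sum_congr rfl fun m _ => ?_
      rw [← Complex.ofReal_ofNat, ← Complex.ofReal_mul, ← Complex.add_conj]
      simp only [map_mul, Complex.conj_conj]
      ring
  rw [hval] at hpos
  exact_mod_cast hpos

open scoped ComplexOrder in
/-- `c ∈ ℭ₊` if and only if the `(n+1)×(n+1)` Hermitian Toeplitz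
matrix with `(j,k)` entry `c_{k−j}` is positive definite. -/
theorem mem_CplusC_iff_toeplitz_posDef (n : ℕ) (hn : 1 ≤ n) (c : Coef n) :
    c ∈ CplusC n ↔
      (Matrix.of fun j k : Fin (n + 1) => cIdx c ((k : ℤ) - (j : ℤ))).PosDef := by
  change c ∈ CplusC n ↔ (toeplitz c).PosDef
  constructor
  · intro hc
    refine .of_dotProduct_mulVec_pos (toeplitz_isHermitian c) fun x hx => ?_
    rw [star_dotProduct_toeplitz_mulVec]
    exact_mod_cast hc _ (normSqCoef_mem_PnnC x) (normSqCoef_ne_zero hx)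
  · intro hc p hp hp0
    obtain ⟨ε, hε, hpd⟩ := hc.exists_sub_smul (toeplitz_isHermitian p)
    rw [← toeplitz_sub_smul] at hpd
    have h := pairCP_nonneg_of_posDef hpd hp
    rw [pairCP_sub_smul] at h
    have := mul_pos hε (pairCP_self_pos hp0)
    linarith
end
end
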